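/- arXiv:2106.04827 — 2 statements merged into one kernel-verified Lean document; each statement's English description precedes it below -/
import Mathlib

section
/- Let C be an n×m real matrix encoding a hypergraph with real coefficients G, let F be a subset of the edges, and suppose the set V_F = { i : C i e ≠ 0 for some e ∈ F } of vertices incident to F has cardinality t with 1 ≤ t and k ranging over {t, …, n−t+1}. Let A(G) be the adjacency matrix of C and A(G∖F) the adjacency matrix of the matrix obtained from C by deleting the columns in F. Then for every k ∈ {t, …, n−t+1}: λ_{k−t+1}(A(G)) ≤ λ_k(A(G∖F)) ≤ λ_{k+t−1}(A(G)). -/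
open Matrix

/-- The degree of vertex `i` in the hypergraph with real coefficients encoded by
the incidence matrix `C`: `deg i = ∑ e, (C i e)^2`. -/
noncomputable def hypDeg {n : ℕ} {E : Type*} [Fintype E] (C : Matrix (Fin n) E ℝ) (i : Fin n) :
    ℝ :=
  ∑ e, (C i e) ^ 2

/-- The adjacency matrix of the hypergraph with real coefficients encoded by `C`:
zero on the diagonal and `A i j = -∑ e, C i e * C j e` off the diagonal. -/
noncomputable def hypAdj {n : ℕ} {E : Type*} [Fintype E] (C : Matrix (Fin n) E ℝ) :
    Matrix (Fin n) (Fin n) ℝ :=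
  Matrix.of fun i j => if i = j then 0 else -∑ e, C i e * C j e

/-- The normalized Laplacian `L = I - D^{-1/2} A D^{-1/2}`. -/
noncomputable def hypNormLap {n : ℕ} {E : Type*} [Fintype E] (C : Matrix (Fin n) E ℝ) :
    Matrix (Fin n) (Fin n) ℝ :=
  1 - Matrix.diagonal (fun i => (Real.sqrt (hypDeg C i))⁻¹) * hypAdj C *
      Matrix.diagonal (fun i => (Real.sqrt (hypDeg C i))⁻¹)

open Classical in
/-- The eigenvalues of a real symmetric matrix, listed in nondecreasing order with
multiplicity; `sortedEig A k` is the `(k+1)`-st smallest eigenvalue (0-indexed).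
(Junk value `0` if `A` is not symmetric.) -/
noncomputable def sortedEig {n : ℕ} (A : Matrix (Fin n) (Fin n) ℝ) : Fin n → ℝ :=
  if hA : A.IsHermitian then hA.eigenvalues ∘ Tuple.sort hA.eigenvalues else 0

lemma hypAdj_herm {n : ℕ} {E : Type*} [Fintype E] (C : Matrix (Fin n) E ℝ) :
    (hypAdj C).IsHermitian := by
  ext i j
  simp only [hypAdj, Matrix.conjTranspose_apply, Matrix.of_apply, star_trivial]
  by_cases h : i = j
  · simp [h]
  · rw [if_neg h, if_neg (Ne.symm h)]
    simp only [mul_comm]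

lemma sortedEig_mono {n : ℕ} (A : Matrix (Fin n) (Fin n) ℝ) : Monotone (sortedEig A) := by
  unfold sortedEig
  split_ifs with h
  · exact Tuple.monotone_sort _
  · exact monotone_const

lemma exists_sorted_basis {n : ℕ} (A : Matrix (Fin n) (Fin n) ℝ) (hA : A.IsHermitian) :
    ∃ b : OrthonormalBasis (Fin n) ℝ (EuclideanSpace ℝ (Fin n)),
      ∀ x, inner ℝ x (Matrix.toEuclideanLin A x) = ∑ i, sortedEig A i * (inner ℝ (b i) x) ^ 2 := by
  refine ⟨hA.eigenvectorBasis.reindex (Tuple.sort hA.eigenvalues).symm, fun x => ?_⟩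
  rw [← OrthonormalBasis.sum_inner_mul_inner
    (hA.eigenvectorBasis.reindex (Tuple.sort hA.eigenvalues).symm)]
  refine Finset.sum_congr rfl fun i _ => ?_
  have hs : (Matrix.toEuclideanLin A).IsSymmetric := Matrix.isSymmetric_toEuclideanLin_iff.mpr hA
  rw [← hs]
  have h2 := hA.mulVec_eigenvectorBasis (Tuple.sort hA.eigenvalues i)
  have h3 : Matrix.toEuclideanLin A (hA.eigenvectorBasis (Tuple.sort hA.eigenvalues i)) =
      hA.eigenvalues (Tuple.sort hA.eigenvalues i) •
        hA.eigenvectorBasis (Tuple.sort hA.eigenvalues i) := by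
    ext j
    simpa [Matrix.toLpLin_apply] using congrFun h2 j
  simp only [OrthonormalBasis.reindex_apply, Equiv.symm_symm, h3, sortedEig, dif_pos hA,
    Function.comp, real_inner_smul_left]
  rw [real_inner_comm]
  ring

lemma weyl_aux {n : ℕ} (A B : Matrix (Fin n) (Fin n) ℝ) (hA : A.IsHermitian) (hB : B.IsHermitian)
    (S : Finset (Fin n))
    (h : ∀ x : EuclideanSpace ℝ (Fin n), (∀ i ∈ S, x i = 0) →
      inner ℝ x (Matrix.toEuclideanLin A x) ≤ inner ℝ x (Matrix.toEuclideanLin B x))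
    (p q : Fin n) (hpq : (q : ℕ) = p + S.card) : sortedEig A p ≤ sortedEig B q := by
  obtain ⟨u, hu⟩ := exists_sorted_basis A hA
  obtain ⟨v, hv⟩ := exists_sorted_basis B hB
  let L : EuclideanSpace ℝ (Fin n) →ₗ[ℝ]
      ((Finset.Iio p → ℝ) × (Finset.Ioi q → ℝ) × (S → ℝ)) :=
    (LinearMap.pi fun i : Finset.Iio p => (innerₛₗ ℝ (u (i : Fin n)))).prod
      ((LinearMap.pi fun i : Finset.Ioi q => (innerₛₗ ℝ (v (i : Fin n)))).prod
        (LinearMap.pi fun i : S => (EuclideanSpace.proj (i : Fin n)).toLinearMap))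
  have hL : LinearMap.ker L ≠ ⊥ := by
    apply LinearMap.ker_ne_bot_of_finrank_lt
    rw [Module.finrank_prod, Module.finrank_prod, Module.finrank_fintype_fun_eq_card,
      Module.finrank_fintype_fun_eq_card, Module.finrank_fintype_fun_eq_card,
      Fintype.card_coe, Fintype.card_coe, Fintype.card_coe, Fin.card_Iio, Fin.card_Ioi,
      finrank_euclideanSpace_fin]
    have := q.2
    omega
  obtain ⟨x, hx, hx0⟩ := (Submodule.ne_bot_iff _).mp hL
  have hx' : L x = 0 := hx
  have h1 : ∀ i < p, inner ℝ (u i) x = 0 := fun i hi =>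
    congrFun (congrArg Prod.fst hx') ⟨i, Finset.mem_Iio.mpr hi⟩
  have h2 : ∀ i > q, inner ℝ (v i) x = 0 := fun i hi =>
    congrFun (congrArg (fun z => z.2.1) hx') ⟨i, Finset.mem_Ioi.mpr hi⟩
  have h3 : ∀ i ∈ S, x i = 0 := fun i hi =>
    congrFun (congrArg (fun z => z.2.2) hx') ⟨i, hi⟩
  have h4 := h x h3
  rw [hu, hv] at h4
  have nu : ∑ i, (inner ℝ (u i) x) ^ 2 = ‖x‖ ^ 2 := by
    simpa using u.sum_sq_norm_inner_right x
  have nv : ∑ i, (inner ℝ (v i) x) ^ 2 = ‖x‖ ^ 2 := by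
    simpa using v.sum_sq_norm_inner_right x
  have h5 : sortedEig A p * ‖x‖ ^ 2 ≤ ∑ i, sortedEig A i * (inner ℝ (u i) x) ^ 2 := by
    rw [← nu, Finset.mul_sum]
    refine Finset.sum_le_sum fun i _ => ?_
    rcases lt_or_ge i p with hi | hi
    · simp [h1 i hi]
    · exact mul_le_mul_of_nonneg_right (sortedEig_mono A hi) (sq_nonneg _)
  have h6 : ∑ i, sortedEig B i * (inner ℝ (v i) x) ^ 2 ≤ sortedEig B q * ‖x‖ ^ 2 := by
    rw [← nv, Finset.mul_sum]
    refine Finset.sum_le_sum fun i _ => ?_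
    rcases lt_or_ge q i with hi | hi
    · simp [h2 i hi]
    · exact mul_le_mul_of_nonneg_right (sortedEig_mono B hi) (sq_nonneg _)
  have hpos : 0 < ‖x‖ ^ 2 := by positivity
  exact le_of_mul_le_mul_right (h5.trans (h4.trans h6)) hpos

lemma hypAdj_form_eq {n m : ℕ} (C : Matrix (Fin n) (Fin m) ℝ) (F : Finset (Fin m))
    (S : Finset (Fin n)) (i0 : Fin n)
    (hS : ∀ i, (∃ e ∈ F, C i e ≠ 0) → i ≠ i0 → i ∈ S)
    (x : EuclideanSpace ℝ (Fin n)) (hx : ∀ i ∈ S, x i = 0) :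
    inner ℝ x (Matrix.toEuclideanLin (hypAdj C) x) =
    inner ℝ x (Matrix.toEuclideanLin
      (hypAdj (C.submatrix id (fun e : {e : Fin m // e ∉ F} => (e : Fin m)))) x) := by
  have key : ∀ i j, i ≠ j → x i ≠ 0 → x j ≠ 0 → ∑ e, C i e * C j e =
      ∑ e : {e : Fin m // e ∉ F}, C i e * C j e := by
    intro i j hij hi hj
    have hz : ∀ e ∈ F, C i e * C j e = 0 := by
      intro e he
      by_contra hne
      have a1 : i = i0 := by
        by_contra hc
        exact hi (hx i (hS i ⟨e, he, left_ne_zero_of_mul hne⟩ hc))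
      have a2 : j = i0 := by
        by_contra hc
        exact hj (hx j (hS j ⟨e, he, right_ne_zero_of_mul hne⟩ hc))
      exact hij (a1.trans a2.symm)
    rw [← Finset.sum_subtype (Finset.univ.filter (· ∉ F)) (by simp) (fun e => C i e * C j e)]
    rw [Finset.sum_filter]
    refine Finset.sum_congr rfl fun e _ => ?_
    by_cases he : e ∈ F
    · simp [he, hz e he]
    · simp [he]
  simp only [PiLp.inner_apply, Matrix.toLpLin_apply, Matrix.mulVec, dotProduct]
  refine Finset.sum_congr rfl fun i _ => ?_
  by_cases hi : x i = 0
  · simp [hi]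
  congr 1
  refine Finset.sum_congr rfl fun j _ => ?_
  by_cases hj : x j = 0
  · simp [hj]
  congr 1
  by_cases hij : i = j
  · simp [hypAdj, hij]
  · simp [hypAdj, hij, key i j hij hi hj]

/-- Interlacing for the adjacency matrix under deletion of a set `F` of edges whose
incident vertex set has cardinality `t`: for `t ≤ k ≤ n - t + 1` (1-based),
`λ_{k-t+1}(A(G)) ≤ λ_k(A(G∖F)) ≤ λ_{k+t-1}(A(G))`. -/
theorem adj_interlacing_edges {n m : ℕ} (C : Matrix (Fin n) (Fin m) ℝ)
    (F : Finset (Fin m)) (t : ℕ)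
    (ht : ({i : Fin n | ∃ e ∈ F, C i e ≠ 0}).ncard = t) (ht1 : 1 ≤ t)
    (k : ℕ) (hk1 : t ≤ k) (hk2 : k + t ≤ n + 1) :
    sortedEig (hypAdj C) ⟨k - t, by omega⟩ ≤
      sortedEig (hypAdj (C.submatrix id (fun e : {e : Fin m // e ∉ F} => (e : Fin m))))
        ⟨k - 1, by omega⟩ ∧
    sortedEig (hypAdj (C.submatrix id (fun e : {e : Fin m // e ∉ F} => (e : Fin m))))
        ⟨k - 1, by omega⟩ ≤
      sortedEig (hypAdj C) ⟨k + t - 2, by omega⟩ := by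
  classical
  obtain ⟨i0, hi0⟩ : ({i : Fin n | ∃ e ∈ F, C i e ≠ 0}).Nonempty := by
    apply Set.nonempty_of_ncard_ne_zero
    omega
  let S : Finset (Fin n) := (({i : Fin n | ∃ e ∈ F, C i e ≠ 0}).toFinset).erase i0
  have hcard : S.card = t - 1 := by
    rw [Finset.card_erase_of_mem (by simpa using hi0), ← Set.ncard_eq_toFinset_card', ht]
  have hS : ∀ i, (∃ e ∈ F, C i e ≠ 0) → i ≠ i0 → i ∈ S := by
    intro i hi hne
    exact Finset.mem_erase.mpr ⟨hne, by simpa using hi⟩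
  constructor
  · refine weyl_aux _ _ (hypAdj_herm _) (hypAdj_herm _) S
      (fun x hx => (hypAdj_form_eq C F S i0 hS x hx).le) _ _ ?_
    simp only [hcard]
    omega
  · refine weyl_aux _ _ (hypAdj_herm _) (hypAdj_herm _) S
      (fun x hx => (hypAdj_form_eq C F S i0 hS x hx).ge) _ _ ?_
    simp only [hcard]
    omega
end

section
/- Let C be an n×m real matrix encoding a hypergraph with real coefficients G in which every vertex has positive degree, let F be a subset of the edges such that every vertex still has positive degree after the columns in F are deleted, and suppose the set V_F = { i : C i e ≠ 0 for some e ∈ F } of vertices incident to F has cardinality t. Let L(G) be the normalized Laplacian of C and L(G∖F) the normalized Laplacian of the matrix obtained from C by deleting the columns in F. Then for every k ∈ {t+1, …, n−t}: λ_{k−t}(L(G)) ≤ λ_k(L(G∖F)) ≤ λ_{k+t}(L(G)). -/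
open Matrix

lemma sortedEig_basis {n : ℕ} (A : Matrix (Fin n) (Fin n) ℝ) (hA : A.IsHermitian) :
    ∃ b : OrthonormalBasis (Fin n) ℝ (EuclideanSpace ℝ (Fin n)),
      ∀ x : EuclideanSpace ℝ (Fin n),
        inner ℝ x (Matrix.toEuclideanLin A x) = ∑ i, sortedEig A i * (inner ℝ (b i) x) ^ 2 := by
  refine ⟨hA.eigenvectorBasis.reindex (Tuple.sort hA.eigenvalues).symm, fun x => ?_⟩
  have hS : (Matrix.toEuclideanLin A).IsSymmetric := Matrix.isSymmetric_toEuclideanLin_iff.mpr hA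
  rw [← OrthonormalBasis.sum_inner_mul_inner
    (hA.eigenvectorBasis.reindex (Tuple.sort hA.eigenvalues).symm)]
  refine Finset.sum_congr rfl fun i _ => ?_
  have hev : Matrix.toEuclideanLin A
      ((hA.eigenvectorBasis.reindex (Tuple.sort hA.eigenvalues).symm) i) =
      sortedEig A i • ((hA.eigenvectorBasis.reindex (Tuple.sort hA.eigenvalues).symm) i) := by
    have := hA.mulVec_eigenvectorBasis (Tuple.sort hA.eigenvalues i)
    ext j
    have hj := congrFun this j
    have hs : sortedEig A i = hA.eigenvalues (Tuple.sort hA.eigenvalues i) := by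
      unfold sortedEig
      rw [dif_pos hA]
      rfl
    rw [hs]
    simpa [Matrix.toLpLin_apply] using hj
  rw [← hS, hev, real_inner_smul_left, real_inner_comm x]
  ring

lemma interlace_aux {n : ℕ} (A B : Matrix (Fin n) (Fin n) ℝ) (hA : A.IsHermitian)
    (hB : B.IsHermitian) (S : Finset (Fin n)) (h : ∀ i j, i ∉ S → j ∉ S → A i j = B i j)
    (a b : Fin n) (hab : (a : ℕ) + S.card = b) : sortedEig A a ≤ sortedEig B b := by
  obtain ⟨u, hu⟩ := sortedEig_basis A hA
  obtain ⟨v, hv⟩ := sortedEig_basis B hB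
  let f : EuclideanSpace ℝ (Fin n) →ₗ[ℝ]
      (((Finset.Iio a : Finset (Fin n)) ⊕ (Finset.Ioi b : Finset (Fin n)) ⊕ S) → ℝ) :=
    LinearMap.pi (Sum.elim (fun i => (innerₛₗ ℝ (u i))) (Sum.elim (fun i => (innerₛₗ ℝ (v i)))
      (fun i => (EuclideanSpace.proj (𝕜 := ℝ) (i : Fin n)).toLinearMap)))
  have hker : LinearMap.ker f ≠ ⊥ := by
    apply LinearMap.ker_ne_bot_of_finrank_lt
    have := b.2
    simp only [Module.finrank_fintype_fun_eq_card, Fintype.card_sum, Fintype.card_coe,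
      Fin.card_Iio, Fin.card_Ioi, finrank_euclideanSpace, Fintype.card_fin]
    omega
  obtain ⟨x, hx, hx0⟩ := Submodule.exists_mem_ne_zero_of_ne_bot hker
  have hx' := fun i => congrFun (LinearMap.mem_ker.mp hx) i
  have h1 : ∀ i, i < a → inner ℝ (u i) x = 0 := fun i hi => by
    simpa [f] using hx' (Sum.inl ⟨i, by simpa using hi⟩)
  have h2 : ∀ i, b < i → inner ℝ (v i) x = 0 := fun i hi => by
    simpa [f] using hx' (Sum.inr (Sum.inl ⟨i, by simpa using hi⟩))
  have h3 : ∀ i ∈ S, x i = 0 := fun i hi => by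
    simpa [f] using hx' (Sum.inr (Sum.inr ⟨i, hi⟩))
  have hAB : inner ℝ x (Matrix.toEuclideanLin A x) = inner ℝ x (Matrix.toEuclideanLin B x) := by
    simp only [PiLp.inner_apply, Matrix.toLpLin_apply, Matrix.mulVec, dotProduct]
    refine Finset.sum_congr rfl fun i _ => ?_
    by_cases hi : i ∈ S
    · simp [h3 i hi]
    · congr 1
      refine Finset.sum_congr rfl fun j _ => ?_
      by_cases hj : j ∈ S
      · simp [h3 j hj]
      · rw [h i j hi hj]
  rw [hu, hv] at hAB
  have hnu : ∑ i, (inner ℝ (u i) x) ^ 2 = ‖x‖ ^ 2 := by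
    simpa using u.sum_sq_norm_inner_right x
  have hnv : ∑ i, (inner ℝ (v i) x) ^ 2 = ‖x‖ ^ 2 := by
    simpa using v.sum_sq_norm_inner_right x
  have hpos : 0 < ‖x‖ ^ 2 := by positivity
  have hl : sortedEig A a * ‖x‖ ^ 2 ≤ ∑ i, sortedEig A i * (inner ℝ (u i) x) ^ 2 := by
    rw [← hnu, Finset.mul_sum]
    refine Finset.sum_le_sum fun i _ => ?_
    by_cases hi : i < a
    · simp [h1 i hi]
    · exact mul_le_mul_of_nonneg_right (sortedEig_mono A (not_lt.mp hi)) (sq_nonneg _)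
  have hr : ∑ i, sortedEig B i * (inner ℝ (v i) x) ^ 2 ≤ sortedEig B b * ‖x‖ ^ 2 := by
    rw [← hnv, Finset.mul_sum]
    refine Finset.sum_le_sum fun i _ => ?_
    by_cases hi : b < i
    · simp [h2 i hi]
    · exact mul_le_mul_of_nonneg_right (sortedEig_mono B (not_lt.mp hi)) (sq_nonneg _)
  exact le_of_mul_le_mul_right (hl.trans (hAB.le.trans hr)) hpos

lemma hypNormLap_isHermitian {n : ℕ} {E : Type*} [Fintype E] (C : Matrix (Fin n) E ℝ) :
    (hypNormLap C).IsHermitian := by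
  ext i j
  by_cases hij : i = j
  · subst hij; simp
  · simp [hypNormLap, hypAdj, Matrix.one_apply, hij, Ne.symm hij, Matrix.mul_diagonal,
      Matrix.diagonal_mul, mul_comm, mul_left_comm]

lemma sum_sub {m : ℕ} (F : Finset (Fin m)) (g : Fin m → ℝ) (hg : ∀ e ∈ F, g e = 0) :
    ∑ e : {e : Fin m // e ∉ F}, g e = ∑ e, g e := by
  rw [← Finset.sum_subtype (Fᶜ) (by simp) g]
  refine Finset.sum_subset (Finset.subset_univ _) fun e _ he => hg e (by simpa using he)

lemma hypNormLap_agree {n m : ℕ} (C : Matrix (Fin n) (Fin m) ℝ) (F : Finset (Fin m))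
    (i j : Fin n) (hi : ∀ e ∈ F, C i e = 0) (hj : ∀ e ∈ F, C j e = 0) :
    hypNormLap C i j =
      hypNormLap (C.submatrix id (fun e : {e : Fin m // e ∉ F} => (e : Fin m))) i j := by
  have hd : ∀ i, (∀ e ∈ F, C i e = 0) →
      hypDeg (C.submatrix id (fun e : {e : Fin m // e ∉ F} => (e : Fin m))) i = hypDeg C i := by
    intro i hi
    exact sum_sub F (fun e => (C i e) ^ 2) (fun e he => by simp [hi e he])
  have ha : hypAdj (C.submatrix id (fun e : {e : Fin m // e ∉ F} => (e : Fin m))) i j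
      = hypAdj C i j := by
    have := sum_sub F (fun e => C i e * C j e) (fun e he => by simp [hi e he])
    simp only [hypAdj, Matrix.of_apply, Matrix.submatrix_apply, id]
    rw [this]
  simp only [hypNormLap, Matrix.sub_apply, Matrix.mul_diagonal, Matrix.diagonal_mul, ha, hd i hi,
    hd j hj]

/-- Interlacing for the normalized Laplacian under deletion of a set `F` of edges whose
incident vertex set has cardinality `t`: for `t + 1 ≤ k ≤ n - t` (1-based),
`λ_{k-t}(L(G)) ≤ λ_k(L(G∖F)) ≤ λ_{k+t}(L(G))`. -/
theorem normLap_interlacing_edges {n m : ℕ} (C : Matrix (Fin n) (Fin m) ℝ)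
    (hdeg : ∀ i, 0 < hypDeg C i)
    (F : Finset (Fin m))
    (hdeg' : ∀ i,
      0 < hypDeg (C.submatrix id (fun e : {e : Fin m // e ∉ F} => (e : Fin m))) i)
    (t : ℕ) (ht : ({i : Fin n | ∃ e ∈ F, C i e ≠ 0}).ncard = t)
    (k : ℕ) (hk1 : t + 1 ≤ k) (hk2 : k + t ≤ n) :
    sortedEig (hypNormLap C) ⟨k - t - 1, by omega⟩ ≤
      sortedEig (hypNormLap (C.submatrix id (fun e : {e : Fin m // e ∉ F} => (e : Fin m))))
        ⟨k - 1, by omega⟩ ∧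
    sortedEig (hypNormLap (C.submatrix id (fun e : {e : Fin m // e ∉ F} => (e : Fin m))))
        ⟨k - 1, by omega⟩ ≤
      sortedEig (hypNormLap C) ⟨k + t - 1, by omega⟩ := by
  classical
  have hS : (Finset.univ.filter fun i : Fin n => ∃ e ∈ F, C i e ≠ 0).card = t := by
    rw [← ht, ← Set.ncard_coe_finset]
    simp
  have hag : ∀ i j, i ∉ (Finset.univ.filter fun i : Fin n => ∃ e ∈ F, C i e ≠ 0) →
      j ∉ (Finset.univ.filter fun i : Fin n => ∃ e ∈ F, C i e ≠ 0) → hypNormLap C i j =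
      hypNormLap (C.submatrix id (fun e : {e : Fin m // e ∉ F} => (e : Fin m))) i j := by
    intro i j hi hj
    exact hypNormLap_agree C F i j (by simpa using hi) (by simpa using hj)
  constructor
  · exact interlace_aux _ _ (hypNormLap_isHermitian _) (hypNormLap_isHermitian _) _ hag _ _
      (by simp only [hS]; omega)
  · exact interlace_aux _ _ (hypNormLap_isHermitian _) (hypNormLap_isHermitian _) _
      (fun i j hi hj => (hag i j hi hj).symm) _ _ (by simp only [hS]; omega)
end
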